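/- arXiv:1901.07710 — 4 statements merged into one kernel-verified Lean document; each statement's English description precedes it below -/
import Mathlib

section
/- Let P be a probability measure on a measurable space X, let f : ℝ → ℝ be strictly convex and differentiable, and let h₁, h₂ : (0,∞) → ℝ be functions satisfying h₁(t) = h₂(t) if and only if t = 1. Let w : X → (0,∞) be measurable and assume f∘(h₁∘w), f∘(h₂∘w) and (f'∘(h₂∘w))·(h₁∘w − h₂∘w) are P-integrable. Then B_f(h₁∘w, h₂∘w; P) = ∫ [f(h₁(w(x))) − f(h₂(w(x))) − f'(h₂(w(x)))(h₁(w(x)) − h₂(w(x)))] dP(x) = 0 if and only if w = 1 P-almost everywhere. -/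
open MeasureTheory Real

/-- A strictly convex function lies strictly above its tangent line at `b`, except at `b`. -/
lemma StrictConvexOn.bregman_pos {S : Set ℝ} {f : ℝ → ℝ} {f' a b : ℝ}
    (hf : StrictConvexOn ℝ S f) (ha : a ∈ S) (hb : b ∈ S) (hab : a ≠ b)
    (hd : HasDerivAt f f' b) : 0 < f a - f b - f' * (a - b) := by
  rcases hab.lt_or_gt with h | h
  · have hs := hf.slope_lt_of_hasDerivAt ha hb h hd
    rw [slope_def_field, div_lt_iff₀ (sub_pos.2 h)] at hs
    linarith
  · have hs := hf.lt_slope_of_hasDerivAt hb ha h hd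
    rw [slope_def_field, lt_div_iff₀ (sub_pos.2 h)] at hs
    linarith

/-- Identification property of the self density-ratio matching
loss: `B_f(h₁∘w, h₂∘w; P) = 0` iff the ratio `w` equals `1` `P`-a.e., where
`f : ℝ → ℝ` is strictly convex and differentiable and `h₁(t) = h₂(t) ↔ t = 1`
on `(0,∞)`. -/
theorem bregman_self_ratio_eq_zero_iff
    {X : Type*} [MeasurableSpace X] (P : Measure X) [IsProbabilityMeasure P]
    (f f' h₁ h₂ : ℝ → ℝ)
    (hconv : StrictConvexOn ℝ Set.univ f)
    (hderiv : ∀ x : ℝ, HasDerivAt f (f' x) x)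
    (hh : ∀ t : ℝ, 0 < t → (h₁ t = h₂ t ↔ t = 1))
    (w : X → ℝ) (hw : Measurable w) (hwpos : ∀ x, 0 < w x)
    (hf1 : Integrable (fun x => f (h₁ (w x))) P)
    (hf2 : Integrable (fun x => f (h₂ (w x))) P)
    (hf3 : Integrable (fun x => f' (h₂ (w x)) * (h₁ (w x) - h₂ (w x))) P) :
    (∫ x, (f (h₁ (w x)) - f (h₂ (w x)) - f' (h₂ (w x)) * (h₁ (w x) - h₂ (w x))) ∂P) = 0 ↔
      w =ᵐ[P] (fun _ => (1 : ℝ)) := by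
  have hpos (x : X) (hx : h₁ (w x) ≠ h₂ (w x)) :
      0 < f (h₁ (w x)) - f (h₂ (w x)) - f' (h₂ (w x)) * (h₁ (w x) - h₂ (w x)) :=
    hconv.bregman_pos (Set.mem_univ _) (Set.mem_univ _) hx (hderiv _)
  refine (integral_eq_zero_iff_of_nonneg (fun x => ?_) ((hf1.sub hf2).sub hf3)).trans ?_
  · by_cases hx : h₁ (w x) = h₂ (w x)
    · simp [hx]
    · exact (hpos x hx).le
  · refine Filter.eventually_congr (.of_forall fun x => ?_)
    rw [← hh (w x) (hwpos x)]
    refine ⟨fun h => ?_, fun h => by simp [h]⟩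
    by_contra hne
    exact (hpos x hne).ne' h
end

section
/- Let f : (0,∞) → ℝ be three times differentiable and satisfy (2z−1)f''(z) + z(z−1)f'''(z) ≥ 0 for all z > 0. Let n ≥ 1, and for i = 1,…,n let a_i > 0 and ξ_i ∈ ℝ^m. Then the function τ ↦ Σ_{i=1}^n [ −f'(z_i(τ)) + z_i(τ)·f'(z_i(τ)) − f(z_i(τ)) ], where z_i(τ) = a_i·exp(⟨τ, ξ_i⟩), is convex on ℝ^m. -/
open Real

/-- The loss `z ↦ -f' z + z f' z - f z` is convex in the log-scale variable `s`, `z = a exp s`. -/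
theorem convexOn_loss_mul_exp {f f' f'' f''' : ℝ → ℝ}
    (hd1 : ∀ z : ℝ, 0 < z → HasDerivAt f (f' z) z)
    (hd2 : ∀ z : ℝ, 0 < z → HasDerivAt f' (f'' z) z)
    (hd3 : ∀ z : ℝ, 0 < z → HasDerivAt f'' (f''' z) z)
    (hcond : ∀ z : ℝ, 0 < z → 0 ≤ (2 * z - 1) * f'' z + z * (z - 1) * f''' z)
    {a : ℝ} (ha : 0 < a) :
    ConvexOn ℝ Set.univ (fun s : ℝ =>
      -(f' (a * Real.exp s)) + (a * Real.exp s) * f' (a * Real.exp s) - f (a * Real.exp s)) := by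
  have hpos (s : ℝ) : 0 < a * Real.exp s := by positivity
  have hz (s : ℝ) : HasDerivAt (fun s => a * Real.exp s) (a * Real.exp s) s :=
    (Real.hasDerivAt_exp s).const_mul a
  have h0 (s : ℝ) := (hd1 _ (hpos s)).comp s (hz s)
  have h1 (s : ℝ) := (hd2 _ (hpos s)).comp s (hz s)
  have h2 (s : ℝ) := (hd3 _ (hpos s)).comp s (hz s)
  have hL (s : ℝ) : HasDerivAt (fun s : ℝ =>
      -(f' (a * Real.exp s)) + (a * Real.exp s) * f' (a * Real.exp s) - f (a * Real.exp s))
      ((a * Real.exp s) * (a * Real.exp s - 1) * f'' (a * Real.exp s)) s := by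
    refine (((h1 s).neg.add ((hz s).mul (h1 s))).sub (h0 s)).congr_deriv ?_
    simp only [Function.comp_apply]
    ring
  have hL' (s : ℝ) : HasDerivAt (fun s : ℝ =>
      (a * Real.exp s) * (a * Real.exp s - 1) * f'' (a * Real.exp s))
      ((a * Real.exp s) * ((2 * (a * Real.exp s) - 1) * f'' (a * Real.exp s) +
        (a * Real.exp s) * (a * Real.exp s - 1) * f''' (a * Real.exp s))) s := by
    refine (((hz s).mul ((hz s).sub_const 1)).mul (h2 s)).congr_deriv ?_
    simp only [Function.comp_apply, Pi.mul_apply]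
    ring
  exact convexOn_of_hasDerivWithinAt2_nonneg convex_univ
    (fun s _ => (hL s).continuousAt.continuousWithinAt)
    (fun s _ => (hL s).hasDerivWithinAt) (fun s _ => (hL' s).hasDerivWithinAt)
    (fun s _ => mul_nonneg (hpos s).le (hcond _ (hpos s)))

/-- Convexity of the separable SDRME loss for unnormalized
exponential models: if `(2z−1)f''(z) + z(z−1)f'''(z) ≥ 0` for all `z > 0`, then
`τ ↦ Σᵢ [−f'(zᵢ(τ)) + zᵢ(τ) f'(zᵢ(τ)) − f(zᵢ(τ))]` with
`zᵢ(τ) = aᵢ exp(⟨τ, ξᵢ⟩)` is convex on `ℝ^m`. -/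
theorem sdrme_loss_convex
    (f f' f'' f''' : ℝ → ℝ)
    (hd1 : ∀ z : ℝ, 0 < z → HasDerivAt f (f' z) z)
    (hd2 : ∀ z : ℝ, 0 < z → HasDerivAt f' (f'' z) z)
    (hd3 : ∀ z : ℝ, 0 < z → HasDerivAt f'' (f''' z) z)
    (hcond : ∀ z : ℝ, 0 < z → 0 ≤ (2 * z - 1) * f'' z + z * (z - 1) * f''' z)
    (n : ℕ) (hn : 1 ≤ n) (m : ℕ)
    (a : Fin n → ℝ) (ha : ∀ i, 0 < a i)
    (ξ : Fin n → (Fin m → ℝ)) :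
    ConvexOn ℝ Set.univ (fun τ : Fin m → ℝ =>
      ∑ i, (-(f' (a i * Real.exp (∑ k, τ k * ξ i k))) +
            (a i * Real.exp (∑ k, τ k * ξ i k)) * f' (a i * Real.exp (∑ k, τ k * ξ i k)) -
            f (a i * Real.exp (∑ k, τ k * ξ i k)))) := by
  refine ⟨convex_univ, fun x _ y _ b c hb hc hbc => ?_⟩
  simp only [smul_eq_mul, Finset.mul_sum, ← Finset.sum_add_distrib]
  refine Finset.sum_le_sum fun i _ => ?_
  have hlin : ∑ k, (b • x + c • y) k * ξ i k
      = b • (∑ k, x k * ξ i k) + c • (∑ k, y k * ξ i k) := by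
    simp only [Pi.add_apply, Pi.smul_apply, smul_eq_mul, Finset.mul_sum,
      ← Finset.sum_add_distrib, add_mul, mul_assoc]
  rw [hlin]
  exact (convexOn_loss_mul_exp hd1 hd2 hd3 hcond (ha i)).2
    (Set.mem_univ _) (Set.mem_univ _) hb hc hbc
end

section
/- Let f(z) = 2z log z − 2(1+z) log(1+z) for z > 0. Then for every z > 0, (2z−1)f''(z) + z(z−1)f'''(z) = 4/(1+z)²; in particular the convexity condition (2z−1)f''(z) + z(z−1)f'''(z) ≥ 0 holds for all z > 0. -/
open Real

lemma jsGenerator_hasDerivAt {z : ℝ} (hz : 0 < z) :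
    HasDerivAt (fun z : ℝ => 2 * z * Real.log z - 2 * (1 + z) * Real.log (1 + z))
      (2 * Real.log z - 2 * Real.log (1 + z)) z := by
  have hz' : 1 + z ≠ 0 := by positivity
  have h1 : HasDerivAt (fun z : ℝ => 1 + z) 1 z := (hasDerivAt_id' z).const_add 1
  refine ((((hasDerivAt_id' z).const_mul 2).fun_mul (Real.hasDerivAt_log hz.ne')).fun_sub
    ((h1.const_mul 2).fun_mul (h1.log hz'))).congr_deriv ?_
  field_simp
  ring

lemma jsGenerator_hasDerivAt_deriv {z : ℝ} (hz : 0 < z) :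
    HasDerivAt (deriv (fun z : ℝ => 2 * z * Real.log z - 2 * (1 + z) * Real.log (1 + z)))
      (2 * z⁻¹ - 2 * (1 + z)⁻¹) z := by
  have hz' : 1 + z ≠ 0 := by positivity
  have h1 : HasDerivAt (fun z : ℝ => 1 + z) 1 z := (hasDerivAt_id' z).const_add 1
  have h : HasDerivAt (fun z : ℝ => 2 * Real.log z - 2 * Real.log (1 + z))
      (2 * z⁻¹ - 2 * (1 + z)⁻¹) z := by
    simpa only [one_div] using
      ((Real.hasDerivAt_log hz.ne').const_mul 2).fun_sub ((h1.log hz').const_mul 2)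
  refine h.congr_of_eventuallyEq ?_
  filter_upwards [lt_mem_nhds hz] with y hy using (jsGenerator_hasDerivAt hy).deriv

lemma jsGenerator_hasDerivAt_deriv_deriv {z : ℝ} (hz : 0 < z) :
    HasDerivAt
      (deriv (deriv (fun z : ℝ => 2 * z * Real.log z - 2 * (1 + z) * Real.log (1 + z))))
      (2 * (-1 / z ^ 2) - 2 * (-1 / (1 + z) ^ 2)) z := by
  have hz' : 1 + z ≠ 0 := by positivity
  have h1 : HasDerivAt (fun z : ℝ => 1 + z) 1 z := (hasDerivAt_id' z).const_add 1
  have h : HasDerivAt (fun z : ℝ => 2 * z⁻¹ - 2 * (1 + z)⁻¹)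
      (2 * (-1 / z ^ 2) - 2 * (-1 / (1 + z) ^ 2)) z :=
    (((hasDerivAt_id' z).fun_inv hz.ne').const_mul 2).fun_sub ((h1.fun_inv hz').const_mul 2)
  refine h.congr_of_eventuallyEq ?_
  filter_upwards [lt_mem_nhds hz] with y hy using (jsGenerator_hasDerivAt_deriv hy).deriv

/-- For `f(z) = 2z log z − 2(1+z) log(1+z)`,
`(2z−1)f''(z) + z(z−1)f'''(z) = 4/(1+z)²` for all `z > 0`; in particular the
convexity condition holds. -/
theorem js_convexity_condition :
    ∀ z : ℝ, 0 < z →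
      ((2 * z - 1) *
          deriv (deriv (fun z : ℝ => 2 * z * Real.log z - 2 * (1 + z) * Real.log (1 + z))) z +
        z * (z - 1) *
          deriv (deriv (deriv
            (fun z : ℝ => 2 * z * Real.log z - 2 * (1 + z) * Real.log (1 + z)))) z =
        4 / (1 + z) ^ 2) ∧
      (0 ≤ (2 * z - 1) *
          deriv (deriv (fun z : ℝ => 2 * z * Real.log z - 2 * (1 + z) * Real.log (1 + z))) z +
        z * (z - 1) *
          deriv (deriv (deriv
            (fun z : ℝ => 2 * z * Real.log z - 2 * (1 + z) * Real.log (1 + z)))) z) := by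
  intro z hz
  rw [(jsGenerator_hasDerivAt_deriv_deriv hz).deriv, (jsGenerator_hasDerivAt_deriv hz).deriv]
  have key : (2 * z - 1) * (2 * z⁻¹ - 2 * (1 + z)⁻¹) +
      z * (z - 1) * (2 * (-1 / z ^ 2) - 2 * (-1 / (1 + z) ^ 2)) = 4 / (1 + z) ^ 2 := by
    have hz' : 1 + z ≠ 0 := by positivity
    field_simp
    ring
  exact ⟨key, key ▸ by positivity⟩
end

section
/- Let m ≥ 2 be a natural number and let f(z) = z^m/(m(m−1)) for z > 0. Then (2z−1)f''(z) + z(z−1)f'''(z) = z^{m−2}·(mz − m + 1) for every z > 0, and this quantity is strictly negative for every z ∈ (0, (m−1)/m); hence f does not satisfy the convexity condition (2z−1)f''(z) + z(z−1)f'''(z) ≥ 0 for all z > 0. -/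
open Real

/-- The second derivative of `z ^ m / (m * (m - 1))` is `z ^ (m - 2)`. -/
theorem deriv_deriv_pow_div (m : ℕ) (hm : 2 ≤ m) :
    deriv (deriv (fun z : ℝ => z ^ m / ((m : ℝ) * ((m : ℝ) - 1)))) =
      fun z : ℝ => z ^ (m - 2) := by
  obtain ⟨k, rfl⟩ := Nat.exists_eq_add_of_le' hm
  have hfirst : deriv (fun z : ℝ => z ^ (k + 2) / (((k + 2 : ℕ) : ℝ) * (((k + 2 : ℕ) : ℝ) - 1))) =
      fun z : ℝ => z ^ (k + 1) / ((k : ℝ) + 1) := by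
    funext z
    have h1 : (k : ℝ) + 1 ≠ 0 := by positivity
    have h2 : (k : ℝ) + 2 ≠ 0 := by positivity
    have h3 : (k : ℝ) + 2 - 1 = k + 1 := by ring
    simp only [deriv_div_const, deriv_pow_field]
    push_cast
    rw [h3]
    field_simp
  rw [hfirst]
  funext z
  have h1 : (k : ℝ) + 1 ≠ 0 := by positivity
  simp only [deriv_div_const, deriv_pow_field]
  push_cast
  field_simp

/-- Multiplying the derivative of `z ^ n` by `z` scales `z ^ n` by `n`. -/
theorem mul_deriv_pow (n : ℕ) (z : ℝ) :
    z * deriv (fun z : ℝ => z ^ n) z = n * z ^ n := by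
  rw [deriv_pow_field]
  cases n with
  | zero => simp
  | succ k => simp only [Nat.add_sub_cancel]; ring

/-- For a natural number `m ≥ 2` and `f(z) = z^m/(m(m−1))`,
`(2z−1)f''(z) + z(z−1)f'''(z) = z^{m−2}(mz − m + 1)` for all `z > 0`, strictly
negative on `(0, (m−1)/m)`; hence the convexity condition fails. -/
theorem beta_convexity_condition_fails (m : ℕ) (hm : 2 ≤ m) :
    (∀ z : ℝ, 0 < z →
      (2 * z - 1) * deriv (deriv (fun z : ℝ => z ^ m / ((m : ℝ) * ((m : ℝ) - 1)))) z +
        z * (z - 1) *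
          deriv (deriv (deriv (fun z : ℝ => z ^ m / ((m : ℝ) * ((m : ℝ) - 1))))) z =
        z ^ (m - 2) * ((m : ℝ) * z - (m : ℝ) + 1)) ∧
    (∀ z : ℝ, 0 < z → z < ((m : ℝ) - 1) / (m : ℝ) →
      (2 * z - 1) * deriv (deriv (fun z : ℝ => z ^ m / ((m : ℝ) * ((m : ℝ) - 1)))) z +
        z * (z - 1) *
          deriv (deriv (deriv (fun z : ℝ => z ^ m / ((m : ℝ) * ((m : ℝ) - 1))))) z < 0) ∧
    ¬ (∀ z : ℝ, 0 < z →
      0 ≤ (2 * z - 1) * deriv (deriv (fun z : ℝ => z ^ m / ((m : ℝ) * ((m : ℝ) - 1)))) z +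
        z * (z - 1) *
          deriv (deriv (deriv (fun z : ℝ => z ^ m / ((m : ℝ) * ((m : ℝ) - 1))))) z) := by
  have hmR : (2 : ℝ) ≤ m := by exact_mod_cast hm
  have hm0 : (0 : ℝ) < m := by linarith
  rw [deriv_deriv_pow_div m hm]
  have heq : ∀ z : ℝ, (2 * z - 1) * z ^ (m - 2) +
      z * (z - 1) * deriv (fun z : ℝ => z ^ (m - 2)) z =
        z ^ (m - 2) * ((m : ℝ) * z - (m : ℝ) + 1) := by
    intro z
    have h := mul_deriv_pow (m - 2) z
    rw [Nat.cast_sub hm] at h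
    push_cast at h
    linear_combination (z - 1) * h
  have hneg : ∀ z : ℝ, 0 < z → z < ((m : ℝ) - 1) / (m : ℝ) →
      (2 * z - 1) * z ^ (m - 2) + z * (z - 1) * deriv (fun z : ℝ => z ^ (m - 2)) z < 0 := by
    intro z hz hzm
    rw [lt_div_iff₀ hm0] at hzm
    rw [heq]
    exact mul_neg_of_pos_of_neg (pow_pos hz _) (by linarith)
  refine ⟨fun z _ => heq z, hneg, fun hall => ?_⟩
  obtain ⟨z, hz, hzm⟩ := exists_between (div_pos (by linarith : (0 : ℝ) < m - 1) hm0)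
  exact (hneg z hz hzm).not_ge (hall z hz)
end
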